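/- arXiv:1601.06529 — 2 statements merged into one kernel-verified Lean document; each statement's English description precedes it below -/
import Mathlib

section
/- For a differentiable strictly convex function f on (0,∞) and positive definite operators A, B on a finite-dimensional complex Hilbert space, the Bregman f-divergence H_f(A,B) = tr(f(A) − f(B) − f'(B)(A − B)) is nonnegative, and H_f(A,B) = 0 if and only if A = B. -/
open Matrix
open scoped ComplexOrder

/-- Standard operator function: apply `f : ℝ → ℝ` to a Hermitian matrix via its
spectral decomposition (junk value `0` for non-Hermitian input). -/
noncomputable def matFun {n : ℕ} (f : ℝ → ℝ) (A : Matrix (Fin n) (Fin n) ℂ) :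
    Matrix (Fin n) (Fin n) ℂ :=
  if hA : A.IsHermitian then
    (hA.eigenvectorUnitary : Matrix (Fin n) (Fin n) ℂ) *
      Matrix.diagonal (fun i => (f (hA.eigenvalues i) : ℂ)) *
      (star (hA.eigenvectorUnitary : Matrix (Fin n) (Fin n) ℂ))
  else 0

/-- Bregman `f`-divergence `H_f(A,B) = tr (f(A) - f(B) - f'(B)(A-B))`. -/
noncomputable def bregman {n : ℕ} (f : ℝ → ℝ) (A B : Matrix (Fin n) (Fin n) ℂ) : ℝ :=
  ((matFun f A - matFun f B - matFun (deriv f) B * (A - B)).trace).re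

/-- Jensen `f`-divergence `J_f(A,B) = tr (½(f(A)+f(B)) - f(½(A+B)))`. -/
noncomputable def jensen {n : ℕ} (f : ℝ → ℝ) (A B : Matrix (Fin n) (Fin n) ℂ) : ℝ :=
  (((1/2 : ℂ) • (matFun f A + matFun f B) - matFun f ((1/2 : ℂ) • (A + B))).trace).re

/-- `P` is a rank-one (orthogonal) projection. -/
def IsRankOneProj {n : ℕ} (P : Matrix (Fin n) (Fin n) ℂ) : Prop :=
  P.IsHermitian ∧ P * P = P ∧ P.rank = 1

theorem bregman_aux_gap (f : ℝ → ℝ)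
    (hconv : StrictConvexOn ℝ (Set.Ioi 0) f)
    (hdiff : ∀ x ∈ Set.Ioi (0 : ℝ), DifferentiableAt ℝ f x)
    (x y : ℝ) (hx : 0 < x) (hy : 0 < y) (hxy : x ≠ y) :
    0 < f x - f y - deriv f y * (x - y) := by
  rcases lt_or_gt_of_ne hxy with h | h
  · have := hconv.slope_lt_deriv hx hy h (hdiff y hy)
    rw [slope_def_field, div_lt_iff₀ (by linarith)] at this
    linarith
  · have := hconv.deriv_lt_slope hy hx h (hdiff y hy)
    rw [slope_def_field, lt_div_iff₀ (by linarith)] at this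
    linarith

/-- Trace of a product of two matrices given in spectral form. -/
theorem bregman_aux_trace {n : ℕ} (U V : Matrix (Fin n) (Fin n) ℂ) (g h : Fin n → ℝ) :
    ((V * diagonal (fun i => (h i : ℂ)) * star V) *
      (U * diagonal (fun i => (g i : ℂ)) * star U)).trace.re
      = ∑ i, ∑ j, g i * h j * Complex.normSq ((star U * V) i j) := by
  have h1 : ((V * diagonal (fun i => (h i : ℂ)) * star V) *
      (U * diagonal (fun i => (g i : ℂ)) * star U)).trace
      = ((star U * V) * (diagonal (fun i => (h i : ℂ)) * star (star U * V) *
        diagonal (fun i => (g i : ℂ)))).trace := by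
    rw [← Matrix.mul_assoc, Matrix.trace_mul_comm]
    simp only [star_mul, star_star, Matrix.mul_assoc]
  rw [h1]
  generalize star U * V = W
  simp only [Matrix.trace, Matrix.diag_apply, Complex.re_sum]
  refine Finset.sum_congr rfl fun i _ => ?_
  rw [Matrix.mul_apply, Complex.re_sum]
  refine Finset.sum_congr rfl fun j _ => ?_
  rw [Matrix.mul_diagonal, Matrix.diagonal_mul, Matrix.star_apply, Complex.normSq_apply]
  simp
  ring

theorem bregman_aux_matFun {n : ℕ} {A : Matrix (Fin n) (Fin n) ℂ} (hA : A.IsHermitian)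
    (f : ℝ → ℝ) : matFun f A = (hA.eigenvectorUnitary : Matrix (Fin n) (Fin n) ℂ) *
      Matrix.diagonal (fun i => (f (hA.eigenvalues i) : ℂ)) *
      (star (hA.eigenvectorUnitary : Matrix (Fin n) (Fin n) ℂ)) := by
  rw [matFun, dif_pos hA]

theorem bregman_aux_id {n : ℕ} {A : Matrix (Fin n) (Fin n) ℂ} (hA : A.IsHermitian) :
    matFun (fun x => x) A = A := by
  rw [bregman_aux_matFun hA]
  conv_rhs => rw [hA.spectral_theorem]
  rw [Unitary.conjStarAlgAut_apply]
  rfl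

theorem bregman_aux_one {n : ℕ} {A : Matrix (Fin n) (Fin n) ℂ} (hA : A.IsHermitian) :
    matFun (fun _ => 1) A = 1 := by
  rw [bregman_aux_matFun hA]
  simp

theorem bregman_aux_mul {n : ℕ} {A : Matrix (Fin n) (Fin n) ℂ} (hA : A.IsHermitian)
    (f g : ℝ → ℝ) : matFun f A * matFun g A = matFun (fun x => f x * g x) A := by
  simp only [bregman_aux_matFun hA]
  have h : star (hA.eigenvectorUnitary : Matrix (Fin n) (Fin n) ℂ) *
    (hA.eigenvectorUnitary : Matrix (Fin n) (Fin n) ℂ) = 1 := by simp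
  generalize (hA.eigenvectorUnitary : Matrix (Fin n) (Fin n) ℂ) = U at *
  rw [show ∀ P Q : Matrix (Fin n) (Fin n) ℂ, U * P * star U * (U * Q * star U)
    = U * (P * (star U * U) * Q) * star U by intros; simp only [Matrix.mul_assoc], h]
  simp [Matrix.diagonal_mul_diagonal]

theorem bregman_aux_sum {n : ℕ} (f : ℝ → ℝ) {A B : Matrix (Fin n) (Fin n) ℂ}
    (hA : A.IsHermitian) (hB : B.IsHermitian) :
    bregman f A B = ∑ i, ∑ j,
      (f (hA.eigenvalues i) - f (hB.eigenvalues j) - deriv f (hB.eigenvalues j) *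
        (hA.eigenvalues i - hB.eigenvalues j)) *
      Complex.normSq ((star (hA.eigenvectorUnitary : Matrix (Fin n) (Fin n) ℂ) *
        (hB.eigenvectorUnitary : Matrix (Fin n) (Fin n) ℂ)) i j) := by
  have key : matFun f A - matFun f B - matFun (deriv f) B * (A - B)
      = matFun (fun _ => 1) B * matFun f A - matFun f B * matFun (fun _ => 1) A
        - matFun (deriv f) B * matFun (fun x => x) A
        + matFun (fun x => deriv f x * x) B * matFun (fun _ => 1) A := by
    rw [← bregman_aux_mul hB, bregman_aux_one hA, bregman_aux_one hB, bregman_aux_id hA,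
      bregman_aux_id hB]
    noncomm_ring
  rw [bregman, key]
  simp only [Matrix.trace_add, Matrix.trace_sub, Complex.add_re, Complex.sub_re]
  simp only [bregman_aux_matFun hA, bregman_aux_matFun hB]
  rw [bregman_aux_trace _ _ (fun i => f (hA.eigenvalues i)) (fun _ => 1),
    bregman_aux_trace _ _ (fun _ => 1) (fun i => f (hB.eigenvalues i)),
    bregman_aux_trace _ _ (fun i => hA.eigenvalues i) (fun i => deriv f (hB.eigenvalues i)),
    bregman_aux_trace _ _ (fun _ => 1)
      (fun i => deriv f (hB.eigenvalues i) * hB.eigenvalues i)]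
  simp only [← Finset.sum_sub_distrib, ← Finset.sum_add_distrib]
  refine Finset.sum_congr rfl fun i _ => Finset.sum_congr rfl fun j _ => ?_
  ring

theorem bregman_aux_eq {n : ℕ} {A B : Matrix (Fin n) (Fin n) ℂ}
    (hA : A.IsHermitian) (hB : B.IsHermitian)
    (h : ∀ i j, hA.eigenvalues i = hB.eigenvalues j ∨
      (star (hA.eigenvectorUnitary : Matrix (Fin n) (Fin n) ℂ) *
        (hB.eigenvectorUnitary : Matrix (Fin n) (Fin n) ℂ)) i j = 0) : A = B := by
  have hU : (hA.eigenvectorUnitary : Matrix (Fin n) (Fin n) ℂ) *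
    star (hA.eigenvectorUnitary : Matrix (Fin n) (Fin n) ℂ) = 1 := by simp
  have hV : (hB.eigenvectorUnitary : Matrix (Fin n) (Fin n) ℂ) *
    star (hB.eigenvectorUnitary : Matrix (Fin n) (Fin n) ℂ) = 1 := by simp
  rw [← bregman_aux_id hA, ← bregman_aux_id hB, bregman_aux_matFun hA, bregman_aux_matFun hB]
  generalize (hA.eigenvectorUnitary : Matrix (Fin n) (Fin n) ℂ) = U at *
  generalize (hB.eigenvectorUnitary : Matrix (Fin n) (Fin n) ℂ) = V at *
  generalize hA.eigenvalues = a at *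
  generalize hB.eigenvalues = b at *
  have hc : diagonal (fun i => (a i : ℂ)) * (star U * V)
      = (star U * V) * diagonal (fun i => (b i : ℂ)) := by
    ext i j
    rw [Matrix.diagonal_mul, Matrix.mul_diagonal]
    rcases h i j with h | h
    · rw [h, mul_comm]
    · rw [h]; simp
  calc U * diagonal (fun i => (a i : ℂ)) * star U
      = U * (diagonal (fun i => (a i : ℂ)) * (star U * V)) * star V := by
        simp only [Matrix.mul_assoc, hV, Matrix.mul_one]
    _ = (U * star U) * V * diagonal (fun i => (b i : ℂ)) * star V := by
        rw [hc]; simp only [Matrix.mul_assoc]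
    _ = _ := by rw [hU, Matrix.one_mul]

/-- nonnegativity of the Bregman divergence and characterization of its kernel. -/
theorem bregman_nonneg_and_eq_zero_iff {n : ℕ} (f : ℝ → ℝ)
    (hconv : StrictConvexOn ℝ (Set.Ioi 0) f)
    (hdiff : ∀ x ∈ Set.Ioi (0 : ℝ), DifferentiableAt ℝ f x)
    (A B : Matrix (Fin n) (Fin n) ℂ) (hA : A.PosDef) (hB : B.PosDef) :
    0 ≤ bregman f A B ∧ (bregman f A B = 0 ↔ A = B) := by
  have hgap : ∀ x y : ℝ, 0 < x → 0 < y → 0 ≤ f x - f y - deriv f y * (x - y) := by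
    intro x y hx hy
    rcases eq_or_ne x y with h | h
    · simp [h]
    · exact (bregman_aux_gap f hconv hdiff x y hx hy h).le
  have hterm := fun i j => mul_nonneg
    (hgap _ _ (hA.eigenvalues_pos i) (hB.eigenvalues_pos j))
    (Complex.normSq_nonneg ((star (hA.1.eigenvectorUnitary : Matrix (Fin n) (Fin n) ℂ) *
        (hB.1.eigenvectorUnitary : Matrix (Fin n) (Fin n) ℂ)) i j))
  refine ⟨?_, ?_, ?_⟩
  · rw [bregman_aux_sum f hA.1 hB.1]
    exact Finset.sum_nonneg fun i _ => Finset.sum_nonneg fun j _ => hterm i j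
  · intro h0
    rw [bregman_aux_sum f hA.1 hB.1] at h0
    refine bregman_aux_eq hA.1 hB.1 fun i j => ?_
    have h1 := (Finset.sum_eq_zero_iff_of_nonneg
      (fun i _ => Finset.sum_nonneg fun j _ => hterm i j)).1 h0 i (Finset.mem_univ i)
    have h2 := (Finset.sum_eq_zero_iff_of_nonneg
      (fun j _ => hterm i j)).1 h1 j (Finset.mem_univ j)
    rcases mul_eq_zero.1 h2 with h3 | h3
    · left
      by_contra hne
      exact (bregman_aux_gap f hconv hdiff _ _ (hA.eigenvalues_pos i)
        (hB.eigenvalues_pos j) hne).ne' h3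
    · right
      exact Complex.normSq_eq_zero.1 h3
  · rintro rfl
    simp [bregman]
end

section
/- Let D be a positive semidefinite operator with largest eigenvalue ν₁ on a finite-dimensional complex Hilbert space, with top eigenprojection P₁, and let f be strictly convex and continuous on [0,∞). Then over rank-one projections R, the quantity tr f(½(R + D)) is maximized exactly when the range of R is contained in the range of P₁, and the maximal value is f(½(ν₁+1)) − f(½ν₁) + tr f(½D). -/
open Matrix
open scoped ComplexOrder

lemma scalar_aux (f : ℝ → ℝ) (hf : StrictConvexOn ℝ (Set.Ici 0) f) (a b m : ℝ)
    (ha : 0 ≤ a) (ham : a ≤ m) (hab : a < b) (hb : b ≤ m + 1/2) :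
    f b - f a ≤ 2 * (b - a) * (f (m + 1/2) - f m) ∧
    (f b - f a = 2 * (b - a) * (f (m + 1/2) - f m) → b = m + 1/2) := by
  have h1 : (f b - f a) / (b - a) ≤ (f (m+1/2) - f a) / (m + 1/2 - a) ∧
      (b < m + 1/2 → (f b - f a) / (b - a) < (f (m+1/2) - f a) / (m + 1/2 - a)) := by
    have key : b < m + 1/2 → (f b - f a) / (b - a) < (f (m+1/2) - f a) / (m + 1/2 - a) := by
      intro h
      exact hf.secant_strict_mono (a := a) (x := b) (y := m + 1/2) ha
        (Set.mem_Ici.2 (by linarith)) (Set.mem_Ici.2 (by linarith)) (by linarith)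
        (by linarith) h
    refine ⟨?_, key⟩
    rcases hb.lt_or_eq with h | h
    · exact (key h).le
    · rw [h]
  have h2 : (f (m+1/2) - f a) / (m + 1/2 - a) ≤ 2 * (f (m + 1/2) - f m) := by
    rcases ham.lt_or_eq with h | h
    · have := hf.secant_strict_mono (a := m + 1/2) (x := a) (y := m)
        (Set.mem_Ici.2 (by linarith)) ha
        (Set.mem_Ici.2 (by linarith)) (by linarith) (by linarith) h
      rw [← neg_div_neg_eq, neg_sub, neg_sub] at this
      refine this.le.trans (le_of_eq ?_)
      rw [show m - (m + 1/2) = -(1/2 : ℝ) by ring]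
      ring
    · subst h
      rw [show a + 1/2 - a = (1/2 : ℝ) by ring]
      apply le_of_eq; ring
  have hpos : 0 < b - a := by linarith
  have e : f b - f a = (f b - f a) / (b - a) * (b - a) := by field_simp
  constructor
  · rw [e]
    have := mul_le_mul_of_nonneg_right (h1.1.trans h2) hpos.le
    linarith
  · intro h
    by_contra hne
    have hlt := (h1.2 (lt_of_le_of_ne hb hne)).trans_le h2
    have := mul_lt_mul_of_pos_right hlt hpos
    rw [← e] at this
    linarith

lemma core_aux {n : ℕ} (f : ℝ → ℝ) (hf : StrictConvexOn ℝ (Set.Ici 0) f) (a b : Fin n → ℝ)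
    (m : ℝ) (ha : ∀ i, 0 ≤ a i) (ham : ∀ i, a i ≤ m) (hab : ∀ i, a i ≤ b i)
    (hs : ∑ i, b i = ∑ i, a i + 1/2) :
    ∑ i, f (b i) ≤ f (m + 1/2) - f m + ∑ i, f (a i) ∧
    (∑ i, f (b i) = f (m + 1/2) - f m + ∑ i, f (a i) ↔ ∃ k, b k = m + 1/2) := by
  have hs' : ∑ i, (b i - a i) = 1/2 := by rw [Finset.sum_sub_distrib]; linarith
  have hle : ∀ i, b i - a i ≤ 1/2 := by
    intro i
    rw [← hs']
    exact Finset.single_le_sum (f := fun i => b i - a i)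
      (fun j _ => sub_nonneg.2 (hab j)) (Finset.mem_univ i)
  have hsum : ∑ i, 2 * (b i - a i) * (f (m + 1/2) - f m) = f (m + 1/2) - f m := by
    rw [← Finset.sum_mul, ← Finset.mul_sum, hs']; ring
  have hterm : ∀ i, f (b i) - f (a i) ≤ 2 * (b i - a i) * (f (m + 1/2) - f m) := by
    intro i
    rcases (hab i).lt_or_eq with h | h
    · exact (scalar_aux f hf _ _ m (ha i) (ham i) h (by linarith [hle i, ham i])).1
    · rw [h]; simp
  refine ⟨?_, ?_, ?_⟩
  · have := Finset.sum_le_sum fun i (_ : i ∈ Finset.univ) => hterm i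
    rw [hsum, Finset.sum_sub_distrib] at this
    linarith
  · intro h
    have heq : ∑ i, (f (b i) - f (a i)) = ∑ i, 2 * (b i - a i) * (f (m + 1/2) - f m) := by
      rw [hsum, Finset.sum_sub_distrib]; linarith
    have hall := (Finset.sum_eq_sum_iff_of_le fun i _ => hterm i).1 heq
    obtain ⟨k, -, hk⟩ : ∃ k ∈ Finset.univ, 0 < b k - a k := by
      apply Finset.exists_lt_of_sum_lt (f := fun _ => (0:ℝ))
      rw [hs']; simp
    exact ⟨k, (scalar_aux f hf _ _ m (ha k) (ham k) (by linarith)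
      (by linarith [hle k, ham k])).2 (hall k (Finset.mem_univ k))⟩
  · rintro ⟨k, hk⟩
    have hak : a k = m := by linarith [hle k, ham k]
    have hoth : ∀ j, j ≠ k → b j - a j = 0 := by
      have h0 : ∑ j ∈ Finset.univ.erase k, (b j - a j) = 0 := by
        have := Finset.add_sum_erase Finset.univ (fun j => b j - a j) (Finset.mem_univ k)
        rw [hs'] at this
        linarith
      intro j hj
      exact (Finset.sum_eq_zero_iff_of_nonneg fun j _ => sub_nonneg.2 (hab j)).1 h0 j
        (by simp [hj])
    have h1 : ∑ j, (f (b j) - f (a j)) = f (b k) - f (a k) := by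
      apply Finset.sum_eq_single k
      · intro j _ hj
        rw [show b j = a j by linarith [hoth j hj]]; simp
      · simp
    rw [Finset.sum_sub_distrib, hk, hak] at h1
    linarith

lemma matFun_trace_re {n : ℕ} (f : ℝ → ℝ) (A : Matrix (Fin n) (Fin n) ℂ) (hA : A.IsHermitian) :
    ((matFun f A).trace).re = ∑ i, f (hA.eigenvalues i) := by
  rw [matFun, dif_pos hA, Matrix.trace_mul_comm, ← mul_assoc]
  simp [Matrix.trace_diagonal]

lemma quad_eq {n : ℕ} (A : Matrix (Fin n) (Fin n) ℂ) (hA : A.IsHermitian)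
    (x : EuclideanSpace ℂ (Fin n)) :
    (star (x : Fin n → ℂ) ⬝ᵥ A *ᵥ (x : Fin n → ℂ)).re =
      ∑ i, hA.eigenvalues i * ‖inner ℂ (hA.eigenvectorBasis i) x‖ ^ 2 := by
  have h0 : star (x : Fin n → ℂ) ⬝ᵥ A *ᵥ (x : Fin n → ℂ) =
      inner ℂ x (Matrix.toEuclideanLin A x) := by
    rw [EuclideanSpace.inner_eq_star_dotProduct, dotProduct_comm]; rfl
  have hsym := Matrix.isSymmetric_toEuclideanLin_iff.mpr hA
  have h1 : ∀ i, inner ℂ (hA.eigenvectorBasis i) (Matrix.toEuclideanLin A x) =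
      (hA.eigenvalues i : ℂ) * inner ℂ (hA.eigenvectorBasis i) x := by
    intro i
    rw [← hsym]
    have : Matrix.toEuclideanLin A (hA.eigenvectorBasis i) =
        (hA.eigenvalues i : ℂ) • hA.eigenvectorBasis i := by
      ext j
      have := congrFun (hA.mulVec_eigenvectorBasis i) j
      simpa using this
    rw [this, inner_smul_left]; simp
  rw [h0, ← hA.eigenvectorBasis.sum_inner_mul_inner, Complex.re_sum]
  refine Finset.sum_congr rfl fun i _ => ?_
  rw [h1, mul_left_comm, Complex.re_ofReal_mul, ← inner_conj_symm, mul_comm (starRingEnd ℂ _),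
    Complex.mul_conj, Complex.normSq_eq_norm_sq, Complex.ofReal_re]

lemma weyl_aux {n : ℕ} (A B : Matrix (Fin n) (Fin n) ℂ) (hA : A.IsHermitian) (hB : B.IsHermitian)
    (hAB : (B - A).PosSemidef) (k : Fin n) : hA.eigenvalues k ≤ hB.eigenvalues k := by
  set e := (Fintype.equivOfCardEq (Fintype.card_fin (Fintype.card (Fin n))) :
    Fin (Fintype.card (Fin n)) ≃ Fin n) with he
  have mA : ∀ i j, e.symm i ≤ e.symm j → hA.eigenvalues j ≤ hA.eigenvalues i :=
    fun i j h => hA.eigenvalues₀_antitone h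
  have mB : ∀ i j, e.symm i ≤ e.symm j → hB.eigenvalues j ≤ hB.eigenvalues i :=
    fun i j h => hB.eigenvalues₀_antitone h
  let w : Fin n → EuclideanSpace ℂ (Fin n) := fun i =>
    if e.symm i < e.symm k then hB.eigenvectorBasis i else hA.eigenvectorBasis i
  let L : EuclideanSpace ℂ (Fin n) →ₗ[ℂ] ({i : Fin n // i ≠ k} → ℂ) :=
    LinearMap.pi fun i => (innerSL ℂ (w i)).toLinearMap
  have hker : LinearMap.ker L ≠ ⊥ := by
    apply LinearMap.ker_ne_bot_of_finrank_lt
    simp [Fintype.card_subtype_compl]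
    exact k.pos
  obtain ⟨x, hx, hx0⟩ := Submodule.exists_mem_ne_zero_of_ne_bot hker
  have hw : ∀ i, i ≠ k → inner ℂ (w i) x = 0 := by
    intro i hi
    have := congrFun (LinearMap.mem_ker.1 hx) ⟨i, hi⟩
    simpa [L] using this
  have q1 : hA.eigenvalues k * ‖x‖ ^ 2 ≤ (star (x : Fin n → ℂ) ⬝ᵥ A *ᵥ (x : Fin n → ℂ)).re := by
    rw [quad_eq A hA, ← hA.eigenvectorBasis.sum_sq_norm_inner_right x, Finset.mul_sum]
    refine Finset.sum_le_sum fun i _ => ?_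
    by_cases h : e.symm i ≤ e.symm k
    · exact mul_le_mul_of_nonneg_right (mA _ _ h) (by positivity)
    · have := hw i (by rintro rfl; simp at h)
      simp only [w, if_neg (fun h' => h (le_of_lt h'))] at this
      rw [this]; simp
  have q2 : (star (x : Fin n → ℂ) ⬝ᵥ B *ᵥ (x : Fin n → ℂ)).re ≤ hB.eigenvalues k * ‖x‖ ^ 2 := by
    rw [quad_eq B hB, ← hB.eigenvectorBasis.sum_sq_norm_inner_right x, Finset.mul_sum]
    refine Finset.sum_le_sum fun i _ => ?_
    by_cases h : e.symm i < e.symm k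
    · have := hw i (by rintro rfl; simp at h)
      simp only [w, if_pos h] at this
      rw [this]; simp
    · exact mul_le_mul_of_nonneg_right (mB _ _ (not_lt.1 h)) (by positivity)
  have q3 : 0 ≤ (star (x : Fin n → ℂ) ⬝ᵥ (B - A) *ᵥ (x : Fin n → ℂ)).re :=
    (Complex.nonneg_iff.1 (hAB.dotProduct_mulVec_nonneg _)).1
  rw [Matrix.sub_mulVec, dotProduct_sub, Complex.sub_re] at q3
  have : 0 < ‖x‖ ^ 2 := by positivity
  exact le_of_mul_le_mul_right (by linarith) this

lemma trace_rankOne_aux {n : ℕ} (R : Matrix (Fin n) (Fin n) ℂ) (hR : IsRankOneProj R) :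
    R.trace = 1 := by
  obtain ⟨h1, h2, h3⟩ := hR
  have hl : ∀ i, h1.eigenvalues i = 0 ∨ h1.eigenvalues i = 1 := by
    intro i
    have e1 := h1.mulVec_eigenvectorBasis i
    have e2 : R *ᵥ (R *ᵥ ⇑(h1.eigenvectorBasis i)) = R *ᵥ ⇑(h1.eigenvectorBasis i) := by
      rw [Matrix.mulVec_mulVec, h2]
    rw [e1, Matrix.mulVec_smul, e1, smul_smul] at e2
    have hne : (⇑(h1.eigenvectorBasis i) : Fin n → ℂ) ≠ 0 := by
      intro h
      apply h1.eigenvectorBasis.orthonormal.ne_zero i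
      ext j; exact congrFun h j
    have e3 := smul_left_injective ℝ hne e2
    have : h1.eigenvalues i * (h1.eigenvalues i - 1) = 0 := by linarith
    rcases mul_eq_zero.1 this with h | h
    · exact Or.inl h
    · exact Or.inr (by linarith)
  rw [h1.rank_eq_card_non_zero_eigs, Fintype.card_subtype] at h3
  have hsum : ∑ i, h1.eigenvalues i = 1 := by
    have : ∀ i, h1.eigenvalues i = if h1.eigenvalues i ≠ 0 then 1 else 0 := by
      intro i
      rcases hl i with h | h <;> simp [h]
    rw [Finset.sum_congr rfl fun i _ => this i, Finset.sum_boole, h3]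
    simp
  rw [h1.trace_eq_sum_eigenvalues]
  have h4 := congrArg Complex.ofReal hsum
  rw [Complex.ofReal_sum, Complex.ofReal_one] at h4
  exact h4

lemma range_rankOne_aux {n : ℕ} (R : Matrix (Fin n) (Fin n) ℂ) (hR : IsRankOneProj R)
    (v : Fin n → ℂ) (hv : v ≠ 0) (hRv : R *ᵥ v = v) (w : Fin n → ℂ) :
    ∃ c : ℂ, R *ᵥ w = c • v := by
  have h3 : Module.finrank ℂ (LinearMap.range R.mulVecLin) = 1 := hR.2.2
  have hvm : v ∈ LinearMap.range R.mulVecLin := ⟨v, hRv⟩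
  obtain ⟨c, hc⟩ := (finrank_eq_one_iff_of_nonzero' (⟨v, hvm⟩ : LinearMap.range R.mulVecLin)
    (by simpa using hv)).1 h3 ⟨R *ᵥ w, ⟨w, rfl⟩⟩
  exact ⟨c, (congrArg Subtype.val hc).symm⟩

lemma exists_fixed_aux {n : ℕ} (R : Matrix (Fin n) (Fin n) ℂ) (hR : IsRankOneProj R) :
    ∃ v : Fin n → ℂ, v ≠ 0 ∧ R *ᵥ v = v := by
  by_contra! h
  have h0 : R = 0 := by
    apply Matrix.ext_of_mulVec_single
    intro i
    by_contra hne
    rw [Matrix.zero_mulVec] at hne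
    exact h _ hne (by rw [Matrix.mulVec_mulVec, hR.2.1])
  have := hR.2.2
  rw [h0] at this
  simp at this

lemma isHermitian_half {n : ℕ} {A : Matrix (Fin n) (Fin n) ℂ} (hA : A.IsHermitian) :
    ((1/2 : ℂ) • A).IsHermitian := by
  unfold Matrix.IsHermitian
  rw [Matrix.conjTranspose_smul, hA.eq]
  congr 1
  simp

lemma mem_spectrum_aux {n : ℕ} {A : Matrix (Fin n) (Fin n) ℂ} {v : Fin n → ℂ} (hv : v ≠ 0)
    {c : ℂ} (h : A *ᵥ v = c • v) : c ∈ spectrum ℂ A := by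
  rw [← Matrix.spectrum_toLin']
  apply Module.End.HasEigenvalue.mem_spectrum
  exact Module.End.hasEigenvalue_of_hasEigenvector
    (Module.End.hasEigenvector_iff.2 ⟨Module.End.mem_eigenspace_iff.2 (by simpa using h), hv⟩)

/-- over rank-one projections `R`, `tr f(½(R+D))` is maximized
exactly when `range R ⊆ range P₁`, the top eigenprojection of `D`. -/
theorem trace_f_half_add_max {n : ℕ} (f : ℝ → ℝ)
    (hconv : StrictConvexOn ℝ (Set.Ici 0) f)
    (hcont : ContinuousOn f (Set.Ici 0))
    (D : Matrix (Fin n) (Fin n) ℂ) (hD : D.PosSemidef)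
    (nu : ℝ) (hmem : (nu : ℂ) ∈ spectrum ℂ D)
    (hmax : ∀ x : ℝ, (x : ℂ) ∈ spectrum ℂ D → x ≤ nu)
    (P₁ : Matrix (Fin n) (Fin n) ℂ) (hP₁herm : P₁.IsHermitian) (hP₁idem : P₁ * P₁ = P₁)
    (hP₁range : ∀ v : Fin n → ℂ, D *ᵥ v = (nu : ℂ) • v ↔ P₁ *ᵥ v = v) :
    ∀ R : Matrix (Fin n) (Fin n) ℂ, IsRankOneProj R →
      ((matFun f ((1/2 : ℂ) • (R + D))).trace).re ≤
          f ((nu + 1) / 2) - f (nu / 2) + ((matFun f ((1/2 : ℂ) • D)).trace).re ∧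
        (((matFun f ((1/2 : ℂ) • (R + D))).trace).re =
            f ((nu + 1) / 2) - f (nu / 2) + ((matFun f ((1/2 : ℂ) • D)).trace).re ↔
          P₁ * R = R) := by
  intro R hR
  have hA : ((1/2 : ℂ) • D).IsHermitian := isHermitian_half hD.1
  have hB : ((1/2 : ℂ) • (R + D)).IsHermitian := isHermitian_half (hR.1.add hD.1)
  have hhalf : (0 : ℂ) ≤ 1/2 := by
    rw [Complex.nonneg_iff]; norm_num
  have hRpsd : R.PosSemidef := by
    have := Matrix.posSemidef_conjTranspose_mul_self R
    rwa [hR.1.eq, hR.2.1] at this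
  have hApsd : ((1/2 : ℂ) • D).PosSemidef := hD.smul hhalf
  have hdiff : ((1/2 : ℂ) • (R + D) - (1/2 : ℂ) • D).PosSemidef := by
    rw [smul_add, add_sub_cancel_right]
    exact hRpsd.smul hhalf
  have hneA : ∀ i, (⇑(hA.eigenvectorBasis i) : Fin n → ℂ) ≠ 0 := by
    intro i h
    apply hA.eigenvectorBasis.orthonormal.ne_zero i
    ext j; exact congrFun h j
  have hneB : ∀ i, (⇑(hB.eigenvectorBasis i) : Fin n → ℂ) ≠ 0 := by
    intro i h
    apply hB.eigenvectorBasis.orthonormal.ne_zero i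
    ext j; exact congrFun h j
  have ham : ∀ i, hA.eigenvalues i ≤ nu / 2 := by
    intro i
    have e1 := hA.mulVec_eigenvectorBasis i
    have e2 : D *ᵥ ⇑(hA.eigenvectorBasis i) =
        ((2 * hA.eigenvalues i : ℝ) : ℂ) • (⇑(hA.eigenvectorBasis i) : Fin n → ℂ) := by
      rw [Matrix.smul_mulVec] at e1
      have := congrArg (fun x => (2 : ℂ) • x) e1
      simp only [smul_smul] at this
      norm_num at this
      rw [this]
      ext j
      simp [mul_assoc]
    have := hmax _ (mem_spectrum_aux (hneA i) e2)
    linarith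
  have hs : ∑ i, hB.eigenvalues i = ∑ i, hA.eigenvalues i + 1/2 := by
    have e1 := hB.trace_eq_sum_eigenvalues
    have e2 := hA.trace_eq_sum_eigenvalues
    have e3 : ((1/2 : ℂ) • (R + D)).trace = 1/2 + ((1/2 : ℂ) • D).trace := by
      rw [smul_add, Matrix.trace_add, Matrix.trace_smul, trace_rankOne_aux R hR]
      simp
    rw [e1, e2] at e3
    apply Complex.ofReal_injective
    rw [Complex.ofReal_add, Complex.ofReal_sum, Complex.ofReal_sum]
    refine e3.trans ((add_comm _ _).trans ?_)
    congr 1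
    norm_num
  have core := core_aux f hconv hA.eigenvalues hB.eigenvalues (nu / 2) hApsd.eigenvalues_nonneg
    ham (fun i => weyl_aux _ _ hA hB hdiff i) hs
  rw [matFun_trace_re f _ hA, matFun_trace_re f _ hB, show (nu + 1) / 2 = nu / 2 + 1 / 2 by ring]
  refine ⟨core.1, core.2.trans ⟨?_, ?_⟩⟩
  · rintro ⟨k, hk⟩
    set v := hB.eigenvectorBasis k with hv
    have hnorm : ‖v‖ = 1 := hB.eigenvectorBasis.orthonormal.1 k
    have qB := hB.eigenvalues_eq k
    have qA : (star (v : Fin n → ℂ) ⬝ᵥ ((1/2 : ℂ) • D) *ᵥ (v : Fin n → ℂ)).re ≤ nu / 2 := by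
      rw [quad_eq _ hA]
      calc _ ≤ ∑ i, nu / 2 * ‖inner ℂ (hA.eigenvectorBasis i) v‖ ^ 2 :=
            Finset.sum_le_sum fun i _ => mul_le_mul_of_nonneg_right (ham i) (by positivity)
        _ = nu / 2 := by
            rw [← Finset.mul_sum, hA.eigenvectorBasis.sum_sq_norm_inner_right, hnorm]; ring
    have qR : 1 ≤ (star (v : Fin n → ℂ) ⬝ᵥ R *ᵥ (v : Fin n → ℂ)).re := by
      rw [hk, ← hv, smul_add, Matrix.add_mulVec, dotProduct_add, map_add] at qB
      have e : RCLike.re (star (v : Fin n → ℂ) ⬝ᵥ ((1/2 : ℂ) • R) *ᵥ (v : Fin n → ℂ)) =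
          1/2 * (star (v : Fin n → ℂ) ⬝ᵥ R *ᵥ (v : Fin n → ℂ)).re := by
        rw [Matrix.smul_mulVec, dotProduct_smul]
        simp
      rw [e] at qB
      have e' : RCLike.re (star (v : Fin n → ℂ) ⬝ᵥ ((1/2 : ℂ) • D) *ᵥ (v : Fin n → ℂ)) =
        (star (v : Fin n → ℂ) ⬝ᵥ ((1/2 : ℂ) • D) *ᵥ (v : Fin n → ℂ)).re := rfl
      rw [e'] at qB
      linarith
    have hvv : star (v : Fin n → ℂ) ⬝ᵥ (v : Fin n → ℂ) = 1 := by
      rw [dotProduct_comm, ← EuclideanSpace.inner_eq_star_dotProduct, inner_self_eq_norm_sq_to_K,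
        hnorm]
      simp
    have hQ : ((1 : Matrix (Fin n) (Fin n) ℂ) - R).PosSemidef := by
      have := Matrix.posSemidef_conjTranspose_mul_self (1 - R)
      rw [Matrix.conjTranspose_sub, Matrix.conjTranspose_one, hR.1.eq] at this
      convert this using 1
      rw [mul_sub, sub_mul, sub_mul, hR.2.1]; simp
    have hRv : R *ᵥ (v : Fin n → ℂ) = v := by
      have h0 := hQ.dotProduct_mulVec_nonneg (v : Fin n → ℂ)
      have h1 : star (v : Fin n → ℂ) ⬝ᵥ (1 - R) *ᵥ (v : Fin n → ℂ) = 0 := by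
        apply le_antisymm _ h0
        rw [Complex.nonneg_iff] at h0
        rw [Complex.le_def]
        refine ⟨?_, h0.2.symm⟩
        rw [Matrix.sub_mulVec, dotProduct_sub, Matrix.one_mulVec, hvv]
        simp only [Complex.sub_re, Complex.one_re, Complex.zero_re]
        linarith
      have h2 := (hQ.dotProduct_mulVec_zero_iff _).1 h1
      rw [Matrix.sub_mulVec, Matrix.one_mulVec, sub_eq_zero] at h2
      exact h2.symm
    have hDv : D *ᵥ (v : Fin n → ℂ) = (nu : ℂ) • (v : Fin n → ℂ) := by
      have e1 := hB.mulVec_eigenvectorBasis k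
      rw [← hv, hk, Matrix.smul_mulVec, Matrix.add_mulVec, hRv] at e1
      ext j
      have e2 := congrFun e1 j
      simp at e2 ⊢
      linear_combination 2 * e2
    have hPv := (hP₁range _).1 hDv
    apply Matrix.ext_of_mulVec_single
    intro i
    obtain ⟨c, hc⟩ := range_rankOne_aux R hR _ (hneB k) hRv (Pi.single i 1)
    rw [← Matrix.mulVec_mulVec, hc, Matrix.mulVec_smul]
    exact congrArg (fun x => c • x) hPv
  · intro hPR
    obtain ⟨v, hv0, hRv⟩ := exists_fixed_aux R hR
    have hPv : P₁ *ᵥ v = v := by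
      rw [← hRv, Matrix.mulVec_mulVec, hPR]
    have hDv := (hP₁range v).2 hPv
    have hBv : ((1/2 : ℂ) • (R + D)) *ᵥ v = ((nu / 2 + 1 / 2 : ℝ) : ℂ) • v := by
      rw [Matrix.smul_mulVec, Matrix.add_mulVec, hRv, hDv]
      ext j
      simp
      ring
    have := mem_spectrum_aux hv0 hBv
    rw [hB.spectrum_eq_image_range] at this
    obtain ⟨x, ⟨k, rfl⟩, hx⟩ := this
    exact ⟨k, Complex.ofReal_injective hx⟩
end
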